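/- Let M₁, M₂ be graded R-modules and let f : M₁ → M₂ be a graded monomorphism. If C₂ is a graded classical 2-absorbing second submodule of the graded R-module f(M₁), then f⁻¹(C₂) is a graded classical 2-absorbing second submodule of M₁. -/

import Mathlib

open Pointwise

section GradedDefs

variable {G : Type*} [Group G] [DecidableEq G] {R : Type*} [CommRing R]
  {M : Type*} [AddCommGroup M] [Module R M]

/-- `R` is a `G`-graded commutative ring via the additive subgroups `𝒜 α`:
`R_α R_β ⊆ R_{αβ}` and `R = ⊕_{α ∈ G} R_α`. -/
structure IsRingGrading (𝒜 : G → AddSubgroup R) : Prop where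
  one_mem : (1 : R) ∈ 𝒜 1
  mul_mem : ∀ ⦃α β : G⦄ ⦃r s : R⦄, r ∈ 𝒜 α → s ∈ 𝒜 β → r * s ∈ 𝒜 (α * β)
  isInternal : DirectSum.IsInternal 𝒜

/-- `M` is a graded module over the `G`-graded ring `R`:
`R_α M_β ⊆ M_{αβ}` and `M = ⊕_{α ∈ G} M_α`. -/
structure IsModuleGrading (𝒜 : G → AddSubgroup R) (ℳ : G → AddSubgroup M) : Prop where
  smul_mem : ∀ ⦃α β : G⦄ ⦃r : R⦄ ⦃m : M⦄, r ∈ 𝒜 α → m ∈ ℳ β → r • m ∈ ℳ (α * β)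
  isInternal : DirectSum.IsInternal ℳ

/-- A submodule `N` of `M` is a graded submodule iff `N = ⊕_{α ∈ G} (N ∩ M_α)`,
equivalently, every element of `N` is a sum of homogeneous elements of `N`. -/
def IsGradedSubmodule (ℳ : G → AddSubgroup M) (N : Submodule R M) : Prop :=
  ∀ n ∈ N, n ∈ Submodule.span R {m : M | m ∈ N ∧ ∃ α, m ∈ ℳ α}

/-- An ideal `I` of `R` is a graded ideal iff `I = ⊕_{α ∈ G} (I ∩ R_α)`. -/
def IsGradedIdeal (𝒜 : G → AddSubgroup R) (I : Ideal R) : Prop :=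
  ∀ r ∈ I, r ∈ Ideal.span {s : R | s ∈ I ∧ ∃ α, s ∈ 𝒜 α}

/-- A proper graded submodule `C` of `M` is completely graded irreducible if whenever
`C = ⋂_{λ ∈ Δ} C_λ` for a family of graded submodules `C_λ`, then `C = C_β` for some `β`. -/
def CompletelyGradedIrreducible (ℳ : G → AddSubgroup M) (C : Submodule R M) : Prop :=
  IsGradedSubmodule ℳ C ∧ C ≠ ⊤ ∧
    ∀ S : Set (Submodule R M), (∀ D ∈ S, IsGradedSubmodule ℳ D) → C = sInf S → C ∈ S

/-- A non-zero graded submodule `C` of `M` is a graded classical 2-absorbing second submodule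
if whenever `r, s, t ∈ h(R)`, `U` is a completely graded irreducible submodule of `M` and
`r·s·t·C ⊆ U`, then `r·s·C ⊆ U` or `s·t·C ⊆ U` or `r·t·C ⊆ U`. -/
def IsGrClassical2AbsorbingSecond (𝒜 : G → AddSubgroup R) (ℳ : G → AddSubgroup M)
    (C : Submodule R M) : Prop :=
  C ≠ ⊥ ∧ IsGradedSubmodule ℳ C ∧
    ∀ r s t : R, (∃ α, r ∈ 𝒜 α) → (∃ β, s ∈ 𝒜 β) → (∃ γ, t ∈ 𝒜 γ) →
      ∀ U : Submodule R M, CompletelyGradedIrreducible ℳ U →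
        r • s • t • C ≤ U → (r • s • C ≤ U ∨ s • t • C ≤ U ∨ r • t • C ≤ U)

/-- A non-zero graded submodule `C` of `M` is a graded strongly classical 2-absorbing second
submodule if whenever `r, s, t ∈ h(R)`, `U₁, U₂, U₃` are completely graded irreducible
submodules of `M` and `r·s·t·C ⊆ U₁ ∩ U₂ ∩ U₃`, then `r·s·C ⊆ U₁ ∩ U₂ ∩ U₃` or
`s·t·C ⊆ U₁ ∩ U₂ ∩ U₃` or `r·t·C ⊆ U₁ ∩ U₂ ∩ U₃`. -/
def IsGrStronglyClassical2AbsorbingSecond (𝒜 : G → AddSubgroup R) (ℳ : G → AddSubgroup M)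
    (C : Submodule R M) : Prop :=
  C ≠ ⊥ ∧ IsGradedSubmodule ℳ C ∧
    ∀ r s t : R, (∃ α, r ∈ 𝒜 α) → (∃ β, s ∈ 𝒜 β) → (∃ γ, t ∈ 𝒜 γ) →
      ∀ U₁ U₂ U₃ : Submodule R M, CompletelyGradedIrreducible ℳ U₁ →
        CompletelyGradedIrreducible ℳ U₂ → CompletelyGradedIrreducible ℳ U₃ →
        r • s • t • C ≤ U₁ ⊓ U₂ ⊓ U₃ →
        (r • s • C ≤ U₁ ⊓ U₂ ⊓ U₃ ∨ s • t • C ≤ U₁ ⊓ U₂ ⊓ U₃ ∨ r • t • C ≤ U₁ ⊓ U₂ ⊓ U₃)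

/-- A non-zero graded submodule `S` of `M` is a graded weakly second submodule if whenever
`r, s ∈ h(R)`, `N` is a graded submodule of `M` and `r·s·S ⊆ N`, then `r·S ⊆ N` or `s·S ⊆ N`. -/
def IsGrWeaklySecond (𝒜 : G → AddSubgroup R) (ℳ : G → AddSubgroup M)
    (S : Submodule R M) : Prop :=
  S ≠ ⊥ ∧ IsGradedSubmodule ℳ S ∧
    ∀ r s : R, (∃ α, r ∈ 𝒜 α) → (∃ β, s ∈ 𝒜 β) →
      ∀ N : Submodule R M, IsGradedSubmodule ℳ N →
        r • s • S ≤ N → (r • S ≤ N ∨ s • S ≤ N)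

/-- A proper graded ideal `I` of `R` is a graded 2-absorbing ideal if whenever `r, s, t ∈ h(R)`
with `r·s·t ∈ I`, then `r·s ∈ I` or `r·t ∈ I` or `s·t ∈ I`. -/
def IsGr2AbsorbingIdeal (𝒜 : G → AddSubgroup R) (I : Ideal R) : Prop :=
  I ≠ ⊤ ∧ IsGradedIdeal 𝒜 I ∧
    ∀ r s t : R, (∃ α, r ∈ 𝒜 α) → (∃ β, s ∈ 𝒜 β) → (∃ γ, t ∈ 𝒜 γ) →
      r * s * t ∈ I → (r * s ∈ I ∨ r * t ∈ I ∨ s * t ∈ I)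

end GradedDefs

/-- The grading induced on the image `f(M₁) = range f`, namely `f(M₁) ∩ (M₂)_α`. -/
def rangeGrading {G : Type*} {R : Type*} [CommRing R] {M₁ M₂ : Type*}
    [AddCommGroup M₁] [Module R M₁] [AddCommGroup M₂] [Module R M₂]
    (f : M₁ →ₗ[R] M₂) (ℳ₂ : G → AddSubgroup M₂) :
    G → AddSubgroup ↥(LinearMap.range f) :=
  fun α => (ℳ₂ α).comap (LinearMap.range f).subtype.toAddMonoidHom

/-- An injective graded additive map reflects homogeneity. -/
theorem mem_of_map_mem_of_injective {G M N : Type*} [DecidableEq G] [AddCommGroup M]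
    [AddCommGroup N] {ℳ : G → AddSubgroup M} {𝒩 : G → AddSubgroup N}
    (hℳ : DirectSum.IsInternal ℳ) (h𝒩 : DirectSum.IsInternal 𝒩) (f : M →+ N)
    (hf : ∀ α, ∀ m ∈ ℳ α, f m ∈ 𝒩 α) (hinj : Function.Injective f) {α : G} {m : M}
    (hm : f m ∈ 𝒩 α) : m ∈ ℳ α := by
  obtain ⟨x, rfl⟩ := hℳ.2 m
  let g : ∀ β, ℳ β →+ 𝒩 β := fun β => (f.comp (ℳ β).subtype).codRestrict _ fun y => hf β y y.2
  have hcomp : (DirectSum.coeAddMonoidHom 𝒩).comp (DirectSum.map g) =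
      f.comp (DirectSum.coeAddMonoidHom ℳ) := by
    ext β y
    simp only [AddMonoidHom.comp_apply, DirectSum.map_of, DirectSum.coeAddMonoidHom_of]
    rfl
  have hmap : DirectSum.map g x = DirectSum.of (fun β => 𝒩 β) α ⟨_, hm⟩ := by
    apply h𝒩.1
    rw [DirectSum.coeAddMonoidHom_of]
    exact DFunLike.congr_fun hcomp x
  have hx : x = DirectSum.of (fun β => ℳ β) α (x α) := by
    refine DFinsupp.ext fun β => ?_
    by_cases h : β = α
    · subst h
      exact (DirectSum.of_eq_same (β := fun γ => ℳ γ) _ _).symm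
    · rw [DirectSum.of_eq_of_ne _ _ _ h]
      have h0 := congrArg Subtype.val (DFunLike.congr_fun hmap β)
      rw [DirectSum.of_eq_of_ne _ _ _ h, DirectSum.map_apply] at h0
      exact Subtype.ext (hinj (h0.trans (map_zero f).symm))
  rw [hx, DirectSum.coeAddMonoidHom_of]
  exact (x α).2

section GradedEquiv

variable {G R M N : Type*} [CommRing R] [AddCommGroup M] [Module R M] [AddCommGroup N]
  [Module R N] {ℳ : G → AddSubgroup M} {𝒩 : G → AddSubgroup N}

theorem IsGradedSubmodule.map_equiv (e : M ≃ₗ[R] N) (he : ∀ α m, m ∈ ℳ α → e m ∈ 𝒩 α)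
    {C : Submodule R M} (hC : IsGradedSubmodule ℳ C) :
    IsGradedSubmodule 𝒩 (C.map (e : M →ₗ[R] N)) := by
  rintro _ ⟨m, hm, rfl⟩
  have h := Submodule.mem_map_of_mem (f := (e : M →ₗ[R] N)) (hC m hm)
  rw [Submodule.map_span] at h
  refine Submodule.span_mono ?_ h
  rintro _ ⟨x, ⟨hx, α, hα⟩, rfl⟩
  exact ⟨Submodule.mem_map_of_mem hx, α, he α x hα⟩

theorem CompletelyGradedIrreducible.map_equiv (e : M ≃ₗ[R] N)
    (he : ∀ α m, m ∈ ℳ α ↔ e m ∈ 𝒩 α) {U : Submodule R M}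
    (hU : CompletelyGradedIrreducible ℳ U) :
    CompletelyGradedIrreducible 𝒩 (U.map (e : M →ₗ[R] N)) := by
  obtain ⟨hgr, hne, hirr⟩ := hU
  have he' : ∀ α n, n ∈ 𝒩 α → e.symm n ∈ ℳ α := fun α n hn => by simpa [he] using hn
  let φ := Submodule.orderIsoMapComap e
  refine ⟨hgr.map_equiv e fun α m => (he α m).1, fun h => hne ?_, fun S hS h => ?_⟩
  · exact φ.injective (h.trans φ.map_top.symm)
  · have hmem : U ∈ φ.symm '' S := by
      refine hirr _ ?_ ?_
      · rintro _ ⟨D, hD, rfl⟩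
        have := (hS D hD).map_equiv e.symm he'
        rwa [Submodule.map_equiv_eq_comap_symm, LinearEquiv.symm_symm] at this
      · rw [sInf_image, ← φ.symm.map_sInf, ← h]
        exact (φ.symm_apply_apply U).symm
    obtain ⟨D, hD, rfl⟩ := hmem
    have hφ : (φ.symm D).map (e : M →ₗ[R] N) = D := φ.apply_symm_apply D
    rwa [hφ]

theorem IsGrClassical2AbsorbingSecond.comap_equiv {𝒜 : G → AddSubgroup R} (e : M ≃ₗ[R] N)
    (he : ∀ α m, m ∈ ℳ α ↔ e m ∈ 𝒩 α) {C : Submodule R N}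
    (hC : IsGrClassical2AbsorbingSecond 𝒜 𝒩 C) :
    IsGrClassical2AbsorbingSecond 𝒜 ℳ (C.comap (e : M →ₗ[R] N)) := by
  obtain ⟨hne, hgr, habs⟩ := hC
  have he' : ∀ α n, n ∈ 𝒩 α → e.symm n ∈ ℳ α := fun α n hn => by simpa [he] using hn
  let φ := Submodule.orderIsoMapComap e
  have hmap : (C.comap (e : M →ₗ[R] N)).map (e : M →ₗ[R] N) = C := φ.apply_symm_apply C
  refine ⟨fun h => hne ?_, ?_, fun r s t hr hs ht U hU h => ?_⟩
  · exact φ.symm.injective (h.trans φ.symm.map_bot.symm)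
  · have := hgr.map_equiv e.symm he'
    rwa [Submodule.map_equiv_eq_comap_symm, LinearEquiv.symm_symm] at this
  · have hsmul : ∀ (a : R) (D : Submodule R M),
        (a • D).map (e : M →ₗ[R] N) = a • D.map (e : M →ₗ[R] N) :=
      fun a D => Submodule.map_pointwise_smul a D _
    have key := habs r s t hr hs ht _ (hU.map_equiv e he)
    rw [← hmap] at key
    simp only [← hsmul] at key
    have hle : ∀ D : Submodule R M,
        D.map (e : M →ₗ[R] N) ≤ U.map (e : M →ₗ[R] N) ↔ D ≤ U := fun D => φ.le_iff_le
    simp only [hle] at key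
    exact key h

end GradedEquiv

theorem stmt7 {G : Type*} [Group G] [DecidableEq G] {R : Type*} [CommRing R]
    {M₁ M₂ : Type*} [AddCommGroup M₁] [Module R M₁] [AddCommGroup M₂] [Module R M₂]
    (𝒜 : G → AddSubgroup R) (ℳ₁ : G → AddSubgroup M₁) (ℳ₂ : G → AddSubgroup M₂)
    (h𝒜 : IsRingGrading 𝒜) (hℳ₁ : IsModuleGrading 𝒜 ℳ₁)
    (hℳ₂ : IsModuleGrading 𝒜 ℳ₂)
    (f : M₁ →ₗ[R] M₂) (hfgr : ∀ α : G, ∀ m ∈ ℳ₁ α, f m ∈ ℳ₂ α)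
    (hfinj : Function.Injective f)
    (C₂ : Submodule R ↥(LinearMap.range f))
    (hC₂ : IsGrClassical2AbsorbingSecond 𝒜 (rangeGrading f ℳ₂) C₂) :
    IsGrClassical2AbsorbingSecond 𝒜 ℳ₁ (Submodule.comap f.rangeRestrict C₂) := by
  refine hC₂.comap_equiv (LinearEquiv.ofInjective f hfinj) fun α m => ⟨hfgr α m, fun hm => ?_⟩
  exact mem_of_map_mem_of_injective hℳ₁.isInternal hℳ₂.isInternal f.toAddMonoidHom hfgr hfinj hm
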